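/- arXiv:1407.5314 — 3 statements merged into one kernel-verified Lean document; each statement's English description precedes it below -/
import Mathlib

section
/- For every k > 0, the normalized Black–Scholes call price tends to 0 exponentially fast at rate k²/2 in the total variance: lim_{v→0⁺} v·ln( N(d₊(k,v)) − e^k·N(d₋(k,v)) ) = −k²/2, where N is the standard normal cumulative distribution function and d±(k,v) := −k/√v ± √v/2. -/
open MeasureTheory Set Filter

noncomputable section

/-- The standard normal cumulative distribution function
`N(x) = (2π)^{-1/2} ∫_{-∞}^x e^{-y²/2} dy`. -/
noncomputable def stdNormalCDF (x : ℝ) : ℝ :=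
  (Real.sqrt (2 * Real.pi))⁻¹ * ∫ y in Set.Iio x, Real.exp (-(y ^ 2) / 2)

/-- `d₊(k,v)` in the Black–Scholes formula. -/
noncomputable def dPlus (k v : ℝ) : ℝ := -k / Real.sqrt v + Real.sqrt v / 2

/-- `d₋(k,v)` in the Black–Scholes formula. -/
noncomputable def dMinus (k v : ℝ) : ℝ := -k / Real.sqrt v - Real.sqrt v / 2

/-- The normalized Black–Scholes call price with log-moneyness `k` and total variance `v`. -/
noncomputable def normBS (k v : ℝ) : ℝ :=
  stdNormalCDF (dPlus k v) - Real.exp k * stdNormalCDF (dMinus k v)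

open Topology

lemma integrable_exp_neg_sq_div_two : Integrable fun z : ℝ => Real.exp (-(z ^ 2) / 2) := by
  convert integrable_exp_neg_mul_sq (b := 1 / 2) (by norm_num) using 3
  ring

lemma integral_exp_neg_sq_div_two :
    ∫ z : ℝ, Real.exp (-(z ^ 2) / 2) = Real.sqrt (2 * Real.pi) := by
  convert integral_gaussian (1 / 2) using 3
  · ring_nf
  · ring

lemma exp_mul_stdNormalCDF_sub (k a s : ℝ) :
    Real.exp k * stdNormalCDF (a - s) = (Real.sqrt (2 * Real.pi))⁻¹ *
      ∫ z in Iio a, Real.exp (k - (z - s) ^ 2 / 2) := by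
  have h : ∫ y in Iio (a - s), Real.exp (-(y ^ 2) / 2)
      = ∫ z in Iio a, Real.exp (-((z - s) ^ 2) / 2) := by
    have := (measurePreserving_sub_right volume s).setIntegral_preimage_emb
      (measurableEmbedding_subRight s) (fun y => Real.exp (-(y ^ 2) / 2)) (Iio (a - s))
    rw [← this]
    simp
  rw [stdNormalCDF, h, mul_left_comm, ← integral_const_mul]
  congr 2
  ext z
  rw [← Real.exp_add]
  ring_nf

lemma integrable_exp_sub_sq_div_two (k s : ℝ) :
    Integrable fun z : ℝ => Real.exp (k - (z - s) ^ 2 / 2) := by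
  refine ((integrable_exp_neg_sq_div_two.comp_sub_right s).const_mul (Real.exp k)).congr
    (ae_of_all _ fun z => ?_)
  simp only [← Real.exp_add]
  ring_nf

/-- The call price as a single integral, with `s = √v` the total volatility. -/
lemma normBS_sq_eq_integral (k : ℝ) {s : ℝ} (hs : 0 < s) :
    normBS k (s ^ 2) = (Real.sqrt (2 * Real.pi))⁻¹ *
      ∫ z in Iio (-k / s + s / 2),
        (Real.exp (-(z ^ 2) / 2) - Real.exp (k - (z - s) ^ 2 / 2)) := by
  have h : -k / s - s / 2 = (-k / s + s / 2) - s := by ring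
  rw [normBS, dPlus, dMinus, Real.sqrt_sq hs.le, h, exp_mul_stdNormalCDF_sub, stdNormalCDF,
    integral_sub integrable_exp_neg_sq_div_two.integrableOn
      (integrable_exp_sub_sq_div_two k s).integrableOn]
  ring

lemma stdNormalCDF_le_exp {a : ℝ} (ha : a ≤ 0) : stdNormalCDF a ≤ Real.exp (-(a ^ 2) / 2) := by
  have hb : ∫ z in Iio a, Real.exp (-(z ^ 2) / 2)
      ≤ ∫ z in Iio a, Real.exp (-(a ^ 2) / 2) * Real.exp (-((z - a) ^ 2) / 2) := by
    refine setIntegral_mono_on integrable_exp_neg_sq_div_two.integrableOn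
      ((integrable_exp_neg_sq_div_two.comp_sub_right a).const_mul _).integrableOn
      measurableSet_Iio fun z hz => ?_
    rw [← Real.exp_add, Real.exp_le_exp]
    nlinarith [mul_nonneg_of_nonpos_of_nonpos ha (sub_nonpos.2 (le_of_lt hz))]
  have hc : ∫ z in Iio a, Real.exp (-(a ^ 2) / 2) * Real.exp (-((z - a) ^ 2) / 2)
      ≤ Real.exp (-(a ^ 2) / 2) * Real.sqrt (2 * Real.pi) := by
    rw [integral_const_mul, ← integral_exp_neg_sq_div_two,
      ← integral_sub_right_eq_self (fun z : ℝ => Real.exp (-(z ^ 2) / 2)) a]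
    gcongr
    · exact ae_of_all _ fun z => (Real.exp_pos _).le
    · exact integrable_exp_neg_sq_div_two.comp_sub_right a
    · exact Measure.restrict_le_self
  have hpos : 0 < Real.sqrt (2 * Real.pi) := by positivity
  rw [stdNormalCDF, inv_mul_le_iff₀ hpos]
  linarith

lemma normBS_sq_le {k s : ℝ} (hs : 0 < s) (h : -k / s + s / 2 ≤ 0) :
    normBS k (s ^ 2) ≤ Real.exp (-((-k / s + s / 2) ^ 2) / 2) := by
  refine le_trans ?_ (stdNormalCDF_le_exp h)
  rw [normBS, dPlus, Real.sqrt_sq hs.le, sub_le_self_iff, stdNormalCDF]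
  exact mul_nonneg (Real.exp_pos _).le
    (mul_nonneg (by positivity) (integral_nonneg fun z => (Real.exp_pos _).le))

lemma le_normBS_sq {k s : ℝ} (hs : 0 < s) (h : -k / s + s / 2 ≤ 0) :
    (Real.sqrt (2 * Real.pi))⁻¹ *
      (Real.exp (-((-k / s + s / 2 - 2) ^ 2) / 2) * (s / (1 + s))) ≤ normBS k (s ^ 2) := by
  rw [normBS_sq_eq_integral k hs]
  set a := -k / s + s / 2 with ha
  have hk : k = s ^ 2 / 2 - a * s := by rw [ha]; field_simp; ring
  have hfac (z : ℝ) : Real.exp (-(z ^ 2) / 2) - Real.exp (k - (z - s) ^ 2 / 2)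
      = Real.exp (-(z ^ 2) / 2) * (1 - Real.exp (-((a - z) * s))) := by
    rw [mul_sub, mul_one, ← Real.exp_add, hk]
    ring_nf
  have hint : Integrable fun z : ℝ =>
      Real.exp (-(z ^ 2) / 2) - Real.exp (k - (z - s) ^ 2 / 2) :=
    integrable_exp_neg_sq_div_two.sub (integrable_exp_sub_sq_div_two k s)
  have hsub : Ioo (a - 2) (a - 1) ⊆ Iio a := fun z hz => by
    have := hz.2
    simp only [mem_Iio]
    linarith
  have hexp : Real.exp (-s) ≤ (1 + s)⁻¹ := by
    rw [Real.exp_neg]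
    exact inv_anti₀ (by positivity) (by linarith [Real.add_one_le_exp s])
  have hfrac : s / (1 + s) = 1 - (1 + s)⁻¹ := by field_simp; ring
  gcongr
  calc Real.exp (-((a - 2) ^ 2) / 2) * (s / (1 + s))
      = ∫ _ in Ioo (a - 2) (a - 1), Real.exp (-((a - 2) ^ 2) / 2) * (s / (1 + s)) := by
        rw [setIntegral_const, Measure.real, Real.volume_Ioo]
        norm_num
    _ ≤ ∫ z in Ioo (a - 2) (a - 1),
          (Real.exp (-(z ^ 2) / 2) - Real.exp (k - (z - s) ^ 2 / 2)) := by
        refine setIntegral_mono_on (integrableOn_const (by simp)) hint.integrableOn measurableSet_Ioo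
          fun z hz => ?_
        rw [hfac]
        obtain ⟨h1, h2⟩ := hz
        have h3 : Real.exp (-((a - z) * s)) ≤ Real.exp (-s) :=
          Real.exp_le_exp.2 (by nlinarith)
        exact mul_le_mul (Real.exp_le_exp.2 (by nlinarith)) (by linarith) (by positivity)
          (Real.exp_pos _).le
    _ ≤ ∫ z in Iio a, (Real.exp (-(z ^ 2) / 2) - Real.exp (k - (z - s) ^ 2 / 2)) := by
        refine setIntegral_mono_set hint.integrableOn ?_ hsub.eventuallyLE
        refine (ae_restrict_mem measurableSet_Iio).mono fun z hz => ?_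
        rw [Pi.zero_apply]
        beta_reduce
        rw [hfac]
        have h3 : Real.exp (-((a - z) * s)) ≤ 1 :=
          Real.exp_le_one_iff.2 (by nlinarith [mul_pos (sub_pos.2 hz) hs])
        exact mul_nonneg (Real.exp_pos _).le (by linarith)

lemma tendsto_sq_mul_log_normBS_sq {k : ℝ} (hk : 0 < k) :
    Tendsto (fun s : ℝ => s ^ 2 * Real.log (normBS k (s ^ 2))) (𝓝[>] 0) (𝓝 (-(k ^ 2) / 2)) := by
  have hneg : ∀ᶠ s : ℝ in 𝓝[>] 0, 0 < s ∧ -k / s + s / 2 ≤ 0 := by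
    have h1 : ∀ᶠ s : ℝ in 𝓝[>] 0, s < min 1 k :=
      (eventually_lt_nhds (by positivity)).filter_mono nhdsWithin_le_nhds
    filter_upwards [self_mem_nhdsWithin, h1] with s (hs : 0 < s) h
    obtain ⟨h1, h2⟩ := lt_min_iff.1 h
    refine ⟨hs, ?_⟩
    have : -k / s + s / 2 = (s ^ 2 / 2 - k) / s := by field_simp; ring
    rw [this]
    exact div_nonpos_of_nonpos_of_nonneg (by nlinarith) hs.le
  have hupper : Tendsto (fun s : ℝ => -((-k + s ^ 2 / 2) ^ 2) / 2) (𝓝[>] 0)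
      (𝓝 (-(k ^ 2) / 2)) := by
    have : Continuous fun s : ℝ => -((-k + s ^ 2 / 2) ^ 2) / 2 := by fun_prop
    simpa using (this.tendsto 0).mono_left nhdsWithin_le_nhds
  have hlower : Tendsto (fun s : ℝ => s ^ 2 * Real.log (Real.sqrt (2 * Real.pi))⁻¹
      + -((-k + s ^ 2 / 2 - 2 * s) ^ 2) / 2
      + (s * (s * Real.log s) - s ^ 2 * Real.log (1 + s))) (𝓝[>] 0) (𝓝 (-(k ^ 2) / 2)) := by
    have h : ContinuousAt (fun s : ℝ => s ^ 2 * Real.log (Real.sqrt (2 * Real.pi))⁻¹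
        + -((-k + s ^ 2 / 2 - 2 * s) ^ 2) / 2
        + (s * (s * Real.log s) - s ^ 2 * Real.log (1 + s))) 0 := by
      have h1 : ContinuousAt (fun s : ℝ => s * Real.log s) 0 :=
        Real.continuous_mul_log.continuousAt
      have h2 : ContinuousAt (fun s : ℝ => Real.log (1 + s)) 0 :=
        ContinuousAt.log (by fun_prop) (by norm_num)
      fun_prop
    simpa using h.tendsto.mono_left nhdsWithin_le_nhds
  refine tendsto_of_tendsto_of_tendsto_of_le_of_le' hlower hupper ?_ ?_
  · filter_upwards [hneg] with s ⟨hs, h⟩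
    have hlog := Real.log_le_log (by positivity) (le_normBS_sq hs h)
    rw [Real.log_mul (by positivity) (by positivity), Real.log_mul (by positivity) (by positivity),
      Real.log_exp, Real.log_div (by positivity) (by positivity)] at hlog
    refine le_trans (le_of_eq ?_) (mul_le_mul_of_nonneg_left hlog (sq_nonneg s))
    field_simp
    ring
  · filter_upwards [hneg] with s ⟨hs, h⟩
    have hpos : 0 < normBS k (s ^ 2) := lt_of_lt_of_le (by positivity) (le_normBS_sq hs h)
    have hlog := Real.log_le_log hpos (normBS_sq_le hs h)
    rw [Real.log_exp] at hlog
    refine (mul_le_mul_of_nonneg_left hlog (sq_nonneg s)).trans (le_of_eq ?_)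
    field_simp

/-- For every `k > 0`,
`lim_{v→0⁺} v · ln(N(d₊(k,v)) − e^k N(d₋(k,v))) = −k²/2`. -/
theorem blackScholes_short_variance_asymptotics (k : ℝ) (hk : 0 < k) :
    Filter.Tendsto (fun v : ℝ => v * Real.log (normBS k v))
      (nhdsWithin 0 (Set.Ioi 0)) (nhds (-(k ^ 2) / 2)) := by
  have hsqrt : Tendsto Real.sqrt (𝓝[>] 0) (𝓝[>] 0) := by
    refine tendsto_nhdsWithin_iff.2 ⟨?_, ?_⟩
    · simpa using (Real.continuous_sqrt.tendsto 0).mono_left nhdsWithin_le_nhds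
    · filter_upwards [self_mem_nhdsWithin] with v hv using Real.sqrt_pos.2 hv
  refine ((tendsto_sq_mul_log_normBS_sq hk).comp hsqrt).congr' ?_
  filter_upwards [self_mem_nhdsWithin] with v (hv : 0 < v)
  simp only [Function.comp_apply, Real.sq_sqrt hv.le]

end
end

section
/- Let G be a real Gaussian random variable with mean 0 and variance ε > 0, and let s > 0 (an upper volatility bound) and n > 0. Then E[ (e^{−n} − e^{−½εs² + sG})⁺ ] ≤ e^{−n}·N( ½s√ε − n/(s√ε) ), where N is the standard normal cumulative distribution function. -/
open MeasureTheory Set Filter ProbabilityTheory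

noncomputable section

lemma stdNormalCDF_eq_gaussianReal_real_Iio (x : ℝ) :
    stdNormalCDF x = (gaussianReal 0 1).real (Iio x) := by
  rw [measureReal_def, gaussianReal_apply_eq_integral 0 one_ne_zero, ENNReal.toReal_ofReal
    (integral_nonneg fun y => gaussianPDFReal_nonneg 0 1 y), stdNormalCDF, ← integral_const_mul]
  simp [gaussianPDFReal]

lemma gaussianReal_real_Iio_sqrt_mul {ε : ℝ} (hε : 0 < ε) (x : ℝ) :
    (gaussianReal 0 ε.toNNReal).real (Iio (√ε * x)) = stdNormalCDF x := by
  have hmap : gaussianReal 0 ε.toNNReal = (gaussianReal 0 1).map (√ε * ·) := by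
    rw [gaussianReal_map_const_mul]
    congr 1
    · simp
    · ext
      simp [hε.le]
  have hpre : (√ε * ·) ⁻¹' Iio (√ε * x) = Iio x := by
    ext y
    simp [mul_lt_mul_iff_right₀ (Real.sqrt_pos.2 hε)]
  rw [hmap, map_measureReal_apply (measurable_const_mul _) measurableSet_Iio, hpre,
    stdNormalCDF_eq_gaussianReal_real_Iio]

/-- If `G` is a centered real Gaussian with variance `ε > 0`, `s > 0` and
`n > 0`, then `E[(e^{−n} − e^{−½εs² + sG})⁺] ≤ e^{−n} · N(½s√ε − n/(s√ε))`. -/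
theorem gaussian_put_upper_bound (ε s n : ℝ) (hε : 0 < ε) (hs : 0 < s) (hn : 0 < n) :
    (∫ g, max (Real.exp (-n) - Real.exp (-(1 / 2) * ε * s ^ 2 + s * g)) 0
        ∂(gaussianReal 0 ε.toNNReal))
      ≤ Real.exp (-n) * stdNormalCDF ((1 / 2) * s * Real.sqrt ε - n / (s * Real.sqrt ε)) := by
  have hsε : 0 < √ε := Real.sqrt_pos.2 hε
  have hthreshold : s * (√ε * ((1 / 2) * s * √ε - n / (s * √ε))) = 1 / 2 * ε * s ^ 2 - n := by
    field_simp
    rw [Real.sq_sqrt hε.le]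
  rw [← gaussianReal_real_Iio_sqrt_mul hε]
  set c := √ε * ((1 / 2) * s * √ε - n / (s * √ε))
  calc
    _ ≤ ∫ g, (Iio c).indicator (fun _ => Real.exp (-n)) g ∂(gaussianReal 0 ε.toNNReal) := by
      refine integral_mono_of_nonneg (ae_of_all _ fun g => le_max_right _ _)
        ((integrable_const _).indicator measurableSet_Iio) (ae_of_all _ fun g => ?_)
      by_cases hg : g < c
      · simp [hg, Real.exp_nonneg]
      · have hle : -n ≤ -(1 / 2) * ε * s ^ 2 + s * g := by
          linarith [mul_le_mul_of_nonneg_left (not_lt.1 hg) hs.le]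
        simpa [hg] using hle
    _ = _ := by
      rw [integral_indicator_const _ measurableSet_Iio, smul_eq_mul, mul_comm]

end
end

section
/- Let 0 < σ̲ ≤ σ̄, k > 0, λ > 0, and let n > 0 satisfy n² > (σ̄²/σ̲²)·(ln(e^k+λ))². For each ε > 0 let G_ε be a real Gaussian random variable with mean 0 and variance ε. Then lim_{ε→0⁺} E[ (e^{−n} − e^{−½εσ̄² + σ̄G_ε})⁺ ] / E[ (e^{−½εσ̲² + σ̲G_ε} − e^k)⁺ ] = 0. -/
open MeasureTheory Set Filter ProbabilityTheory

noncomputable section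

/-- Chernoff bound for the expected payoff of a put on a driftless lognormal variable. -/
lemma integral_put_gaussianReal_le {ε σ n : ℝ} (hε : 0 < ε) (hσ : 0 < σ) (hn : 0 < n) :
    ∫ g, max (Real.exp (-n) - Real.exp (-(1 / 2) * ε * σ ^ 2 + σ * g)) 0
        ∂(gaussianReal 0 ε.toNNReal) ≤
      Real.exp (n / 2) * Real.exp (-((n / σ) ^ 2 / (2 * ε))) := by
  set b := n / σ with hb
  have hbσ : b * σ = n := by rw [hb]; field_simp
  have hb0 : 0 < b := div_pos hn hσ
  have hbound : ∀ g : ℝ,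
      max (Real.exp (-n) - Real.exp (-(1 / 2) * ε * σ ^ 2 + σ * g)) 0 ≤
        Real.exp (-(b / ε) * (b - ε * σ / 2)) * Real.exp (-(b / ε) * g) := by
    intro g
    refine max_le ?_ (by positivity)
    rw [← Real.exp_add, ← mul_add]
    rcases le_or_gt (b - ε * σ / 2 + g) 0 with h | h
    · have h1 : 1 ≤ Real.exp (-(b / ε) * (b - ε * σ / 2 + g)) := by
        rw [Real.one_le_exp_iff]
        have := div_pos hb0 hε
        nlinarith
      have h2 : Real.exp (-n) ≤ 1 := Real.exp_le_one_iff.2 (by linarith)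
      linarith [Real.exp_pos (-(1 / 2) * ε * σ ^ 2 + σ * g)]
    · have h1 : Real.exp (-n) ≤ Real.exp (-(1 / 2) * ε * σ ^ 2 + σ * g) := by
        apply Real.exp_le_exp.2
        nlinarith
      linarith [Real.exp_pos (-(b / ε) * (b - ε * σ / 2 + g))]
  refine (integral_mono_of_nonneg (ae_of_all _ fun g => le_max_right _ _)
    ((integrable_exp_mul_gaussianReal _).const_mul _) (ae_of_all _ hbound)).trans ?_
  have hmgf := congrFun (mgf_id_gaussianReal (μ := 0) (v := ε.toNNReal)) (-(b / ε))
  simp only [mgf, id] at hmgf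
  rw [integral_const_mul, hmgf, Real.coe_toNNReal _ hε.le, ← Real.exp_add, ← Real.exp_add,
    ← hbσ]
  apply le_of_eq
  congr 1
  field_simp
  ring

/-- Lower bound for the Gaussian measure of a set containing a short interval. -/
lemma mul_le_gaussianReal_real_of_Icc_subset {ε c w : ℝ} (hε : 0 < ε) (hc : 0 ≤ c) (hw : 0 ≤ w)
    {s : Set ℝ} (hs : Icc c (c + w) ⊆ s) :
    w * ((√(2 * Real.pi * ε))⁻¹ * Real.exp (-(c + w) ^ 2 / (2 * ε))) ≤
      (gaussianReal 0 ε.toNNReal).real s := by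
  have hv : ε.toNNReal ≠ 0 := (Real.toNNReal_pos.2 hε).ne'
  refine le_trans ?_ (measureReal_mono hs)
  rw [measureReal_def, gaussianReal_apply_eq_integral _ hv, ENNReal.toReal_ofReal
    (integral_nonneg fun x => gaussianPDFReal_nonneg _ _ _)]
  have hconst : ∫ _ in Icc c (c + w),
      ((√(2 * Real.pi * ε))⁻¹ * Real.exp (-(c + w) ^ 2 / (2 * ε))) =
      w * ((√(2 * Real.pi * ε))⁻¹ * Real.exp (-(c + w) ^ 2 / (2 * ε))) := by
    simp [hw]
  rw [← hconst]
  refine setIntegral_mono_on continuousOn_const.integrableOn_Icc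
    (integrable_gaussianPDFReal _ _).integrableOn
    measurableSet_Icc fun x hx => ?_
  rw [gaussianPDFReal_def]
  simp only [Real.coe_toNNReal _ hε.le, sub_zero]
  gcongr
  · exact hc.trans hx.1
  · exact hx.2

/-- Lower bound for the expected payoff of a call on a driftless lognormal variable. -/
lemma le_integral_call_gaussianReal {ε σ K lam : ℝ} (hε : 0 < ε) (hε1 : ε ≤ 1) (hσ : 0 < σ)
    (hlam : 0 < lam) (hK : 0 < K) (hL : 0 ≤ Real.log (K + lam)) :
    lam * (ε * ((√(2 * Real.pi))⁻¹ * (Real.exp (-((Real.log (K + lam) / σ) ^ 2 / (2 * ε))) *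
        Real.exp (-(Real.log (K + lam) / σ * (σ / 2 + 1) + (σ / 2 + 1) ^ 2))))) ≤
      ∫ g, max (Real.exp (-(1 / 2) * ε * σ ^ 2 + σ * g) - K) 0
        ∂(gaussianReal 0 ε.toNNReal) := by
  set l := Real.log (K + lam) / σ with hl
  have hlσ : σ * l = Real.log (K + lam) := by rw [hl]; field_simp
  have hl0 : 0 ≤ l := div_nonneg hL hσ.le
  have hint : Integrable (fun g => max (Real.exp (-(1 / 2) * ε * σ ^ 2 + σ * g) - K) 0)
      (gaussianReal 0 ε.toNNReal) := by
    refine Integrable.pos_part (f := fun g => Real.exp (-(1 / 2) * ε * σ ^ 2 + σ * g) - K) ?_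
    refine Integrable.sub ?_ (integrable_const _)
    simp_rw [Real.exp_add]
    exact (integrable_exp_mul_gaussianReal σ).const_mul _
  refine le_trans ?_ (mul_meas_ge_le_integral_of_nonneg
    (ae_of_all _ fun g => le_max_right _ _) hint lam)
  have hsub : Icc (l + ε * σ / 2) (l + ε * σ / 2 + ε) ⊆
      {g | lam ≤ max (Real.exp (-(1 / 2) * ε * σ ^ 2 + σ * g) - K) 0} := by
    intro g hg
    have : K + lam ≤ Real.exp (-(1 / 2) * ε * σ ^ 2 + σ * g) := by
      rw [← Real.log_le_iff_le_exp (by positivity), ← hlσ]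
      nlinarith [mul_le_mul_of_nonneg_left hg.1 hσ.le]
    exact le_max_of_le_left (le_sub_iff_add_le'.2 this)
  refine mul_le_mul_of_nonneg_left (le_trans ?_
    (mul_le_gaussianReal_real_of_Icc_subset hε (by positivity) hε.le hsub)) hlam.le
  rw [← Real.exp_add]
  gcongr ε * ((√?_)⁻¹ * Real.exp ?_)
  · nlinarith [Real.pi_pos]
  · have h : -(l + ε * σ / 2 + ε) ^ 2 / (2 * ε) =
        -(l ^ 2 / (2 * ε)) - l * (σ / 2 + 1) - ε / 2 * (σ / 2 + 1) ^ 2 := by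
      field_simp
      ring
    rw [h]
    nlinarith [sq_nonneg (σ / 2 + 1)]

lemma tendsto_inv_mul_exp_neg_div_nhdsGT_zero {d : ℝ} (hd : 0 < d) :
    Tendsto (fun ε : ℝ => ε⁻¹ * Real.exp (-(d / ε))) (nhdsWithin 0 (Ioi 0)) (nhds 0) := by
  have h := (tendsto_rpow_mul_exp_neg_mul_atTop_nhds_zero 1 d hd).comp tendsto_inv_nhdsGT_zero
  refine h.congr fun ε => ?_
  simp [div_eq_mul_inv]

/-- Let `0 < σ̲ ≤ σ̄`, `k > 0`, `λ > 0` and `n > 0` with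
`n² > (σ̄²/σ̲²)(ln(e^k+λ))²`. For `ε > 0` let `G_ε` be a centered Gaussian with variance `ε`.
Then `E[(e^{−n} − e^{−½εσ̄² + σ̄G_ε})⁺] / E[(e^{−½εσ̲² + σ̲G_ε} − e^k)⁺] → 0` as `ε → 0⁺`. -/
theorem gaussian_ratio_vanishes (σlo σhi k lam n : ℝ)
    (hσlo : 0 < σlo) (hσ : σlo ≤ σhi) (hk : 0 < k) (hlam : 0 < lam) (hn : 0 < n)
    (hn2 : n ^ 2 > (σhi ^ 2 / σlo ^ 2) * (Real.log (Real.exp k + lam)) ^ 2) :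
    Filter.Tendsto (fun ε : ℝ =>
        (∫ g, max (Real.exp (-n) - Real.exp (-(1 / 2) * ε * σhi ^ 2 + σhi * g)) 0
            ∂(gaussianReal 0 ε.toNNReal)) /
        (∫ g, max (Real.exp (-(1 / 2) * ε * σlo ^ 2 + σlo * g) - Real.exp k) 0
            ∂(gaussianReal 0 ε.toNNReal)))
      (nhdsWithin 0 (Set.Ioi 0)) (nhds 0) := by
  have hσhi : 0 < σhi := hσlo.trans_le hσ
  have hL : 0 ≤ Real.log (Real.exp k + lam) :=
    Real.log_nonneg (by linarith [Real.one_lt_exp_iff.2 hk])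
  set l := Real.log (Real.exp k + lam) / σlo with hl
  set b := n / σhi with hb
  have hd : 0 < (b ^ 2 - l ^ 2) / 2 := by
    have : l ^ 2 < b ^ 2 := by
      rw [hb, div_pow n, lt_div_iff₀ (by positivity)]
      refine lt_of_eq_of_lt ?_ hn2
      rw [hl]
      ring
    linarith
  set A := Real.exp (-(l * (σlo / 2 + 1) + (σlo / 2 + 1) ^ 2)) with hA
  have hA0 : 0 < A := Real.exp_pos _
  have hlim := (tendsto_inv_mul_exp_neg_div_nhdsGT_zero hd).const_mul
    (Real.exp (n / 2) * √(2 * Real.pi) / (lam * A))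
  rw [mul_zero] at hlim
  refine squeeze_zero' ?_ ?_ hlim
  · exact Eventually.of_forall fun ε => div_nonneg
      (integral_nonneg fun g => le_max_right _ _) (integral_nonneg fun g => le_max_right _ _)
  · filter_upwards [Ioc_mem_nhdsGT (zero_lt_one' ℝ)] with ε hε
    have hε0 : 0 < ε := hε.1
    have hpi := Real.pi_pos
    refine (div_le_div₀ (by positivity) (integral_put_gaussianReal_le hε0 hσhi hn)
      (by positivity)
      (le_integral_call_gaussianReal hε0 hε.2 hσlo hlam (Real.exp_pos k) hL)).trans_eq ?_
    have hexp : Real.exp (-((n / σhi) ^ 2 / (2 * ε))) =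
        Real.exp (-((b ^ 2 - l ^ 2) / 2 / ε)) * Real.exp (-(l ^ 2 / (2 * ε))) := by
      rw [← Real.exp_add, ← hb]
      congr 1
      field_simp
      ring
    rw [hexp, ← hl, ← hA]
    field_simp

end
end
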